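/- Let n be a positive integer and let K be a field. Consider the n × n Latin squares all of whose diagonal entries equal the symbol n, and suppose that the number of even such Latin squares minus the number of odd such Latin squares is nonzero when regarded as an element of K. Then there exists an online algorithm that sequentially takes n bases of K^n, each of which contains the standard basis vector e_n, and arranges them as the rows of an n × n array whose columns are also bases. Precisely: there exist functions s_1,…,s_n, where s_i maps an i × n array of vectors of K^n to a permutation of {1,…,n}, such that for every n × n array (v_{ij}) of vectors in K^n in which each row is a basis of K^n containing e_n as one of its entries, setting π_i := s_i(v_{1•},…,v_{i•}), every column j of the rearranged array (v_{1,π_1(j)}, …, v_{n,π_n(j)}) is a basis of K^n. -/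

import Mathlib

/-- The signed count (number of even minus number of odd) of those Latin
squares of order `n` whose diagonal entries all equal the symbol `n` (the last
symbol, i.e. the entry with value `n - 1` in `Fin n`).  A Latin square is
encoded as a pair `p = (r, c)` where `r i` is the permutation given by the
`i`-th row and `c j` the permutation given by the `j`-th column; the
compatibility condition `c j i = r i j` says that `r` and `c` come from one and
the same square array, and each square contributes its sign. -/
def latinSquareDiagSignedCount (n : ℕ) : ℤ :=
  ∑ p ∈ Finset.univ.filter
      (fun p : (Fin n → Equiv.Perm (Fin n)) × (Fin n → Equiv.Perm (Fin n)) =>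
        (∀ i j, p.2 j i = p.1 i j) ∧ ∀ i, ((p.1 i i : Fin n) : ℕ) = n - 1),
    (((∏ i, Equiv.Perm.sign (p.1 i)) * ∏ j, Equiv.Perm.sign (p.2 j) : ℤˣ) : ℤ)

noncomputable section OnlineRota

namespace OnlineRota

open Finset

variable {n : ℕ} {K : Type*} [Field K]

/-- product of column determinants -/
def P (u : Fin n → Fin n → (Fin n → K)) : K := ∏ j, Matrix.det (Matrix.of fun i => u i j)

/-- integer sign in the field -/
def sg (K : Type*) [Field K] (τ : Equiv.Perm (Fin n)) : K := ((Equiv.Perm.sign τ : ℤ) : K)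

/-- linear form of a column -/
def phi (Q : Fin n → Fin n → (Fin n → K)) (i j : Fin n) : (Fin n → K) →ₗ[K] K :=
  (Matrix.detRowAlternating (n := Fin n) (R := K)).toMultilinearMap.toLinearMap (fun k => Q k j) i

theorem P_update (Q : Fin n → Fin n → (Fin n → K)) (i : Fin n) (x : Fin n → Fin n → K) :
    P (Function.update Q i x) = ∏ j, phi Q i j (x j) := by
  unfold P phi
  refine Finset.prod_congr rfl fun j _ => ?_
  simp only [MultilinearMap.toLinearMap_apply]
  change _ = Matrix.det (Matrix.of (Function.update (fun k => Q k j) i (x j)))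
  congr 2
  funext k
  by_cases h : k = i
  · subst h; simp
  · simp [h]

theorem phi_zero (Q : Fin n → Fin n → (Fin n → K)) (N i j : Fin n) (hij : j ≠ i)
    (hQ : Q j j = Pi.single N 1) : phi Q i j (Pi.single N 1) = 0 := by
  unfold phi
  simp only [MultilinearMap.toLinearMap_apply]
  refine (Matrix.detRowAlternating (n := Fin n) (R := K)).map_eq_zero_of_eq _ (i := i) (j := j) ?_ hij.symm
  simp [hij, hQ]

theorem sum_full (Q : Fin n → Fin n → (Fin n → K)) (i : Fin n) (w : Fin n → Fin n → K) :
    ∑ π : Equiv.Perm (Fin n), sg K π * ∏ j, phi Q i j (w (π j)) =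
      Matrix.det (Matrix.of w) * Matrix.det (Matrix.of fun j l => phi Q i j (Pi.single l 1)) := by
  have h : (Matrix.of fun k j => phi Q i j (w k)) =
      (Matrix.of w) * (Matrix.of fun j l => phi Q i j (Pi.single l 1)).transpose := by
    ext k j
    rw [Matrix.mul_apply]
    simp only [Matrix.of_apply, Matrix.transpose_apply]
    conv_lhs => rw [pi_eq_sum_univ' (w k)]
    rw [map_sum]
    refine Finset.sum_congr rfl fun l _ => ?_
    rw [map_smul, smul_eq_mul]
  rw [← Matrix.det_transpose (Matrix.of fun j l => phi Q i j (Pi.single l 1)), ← Matrix.det_mul, ← h,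
    Matrix.det_apply']
  simp [sg]

theorem sum_restr (Q : Fin n → Fin n → (Fin n → K)) (N i : Fin n)
    (hQ : ∀ k, k ≠ i → Q k k = Pi.single N 1) (w : Fin n → Fin n → K) (j0 : Fin n)
    (hw : w j0 = Pi.single N 1) :
    ∑ π : Equiv.Perm (Fin n), (if π i = j0 then sg K π else 0) *
        P (Function.update Q i (fun j => w (π j))) =
      Matrix.det (Matrix.of w) * Matrix.det (Matrix.of fun j l => phi Q i j (Pi.single l 1)) := by
  rw [← sum_full]
  refine Finset.sum_congr rfl fun π _ => ?_
  rw [P_update]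
  split_ifs with h
  · rfl
  · rw [zero_mul]
    symm
    apply mul_eq_zero_of_right
    have hne : π.symm j0 ≠ i := by
      rintro rfl; simp at h
    apply Finset.prod_eq_zero (Finset.mem_univ (π.symm j0))
    rw [Equiv.apply_symm_apply, hw]
    exact phi_zero Q N i _ hne (hQ _ hne)

theorem key (Q : Fin n → Fin n → (Fin n → K)) (N i : Fin n)
    (hQ : ∀ k, k ≠ i → Q k k = Pi.single N 1) (w : Fin n → Fin n → K) (j0 : Fin n)
    (hw : w j0 = Pi.single N 1) :
    ∑ π : Equiv.Perm (Fin n), (if π i = j0 then sg K π else 0) *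
        P (Function.update Q i (fun j => w (π j))) =
      Matrix.det (Matrix.of w) * ∑ τ : Equiv.Perm (Fin n), (if τ i = N then sg K τ else 0) *
        P (Function.update Q i (fun j => Pi.single (τ j) 1)) := by
  rw [sum_restr Q N i hQ w j0 hw, sum_restr Q N i hQ (fun l => Pi.single l 1) N rfl]
  have : (Matrix.of fun l : Fin n => (Pi.single l 1 : Fin n → K)) = 1 := by
    ext a b
    simp [Matrix.one_apply, Pi.single_apply, eq_comm]
  rw [this, Matrix.det_one, one_mul]

/-- weights -/
def wt (K : Type*) [Field K] (N : Fin n) (i : ℕ) (k : Fin n) (τ : Equiv.Perm (Fin n)) : K :=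
  if (k : ℕ) < i then (if τ = 1 then 1 else 0) else (if τ k = N then sg K τ else 0)

/-- mixture of given rows and standard rows -/
def mix (i : ℕ) (u : Fin n → Fin n → (Fin n → K)) (σ : Fin n → Equiv.Perm (Fin n)) :
    Fin n → Fin n → (Fin n → K) :=
  fun k j => if (k : ℕ) < i then u k j else Pi.single (σ k j) 1

/-- the invariant -/
def C (N : Fin n) (i : ℕ) (u : Fin n → Fin n → (Fin n → K)) : K :=
  ∑ σ : Fin n → Equiv.Perm (Fin n), (∏ k, wt K N i k (σ k)) * P (mix i u σ)

theorem sum_split {α : Type*} [Fintype α] [DecidableEq α] (a0 : α) (i : Fin n)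
    (f : (Fin n → α) → K) :
    ∑ σ, f σ = ∑ σ, if σ i = a0 then ∑ τ, f (Function.update σ i τ) else 0 := by
  rw [← (Equiv.funSplitAt i α).symm.sum_comp, ← (Equiv.funSplitAt i α).symm.sum_comp,
    Fintype.sum_prod_type, Fintype.sum_prod_type, Finset.sum_comm]
  symm
  rw [Finset.sum_comm]
  refine Finset.sum_congr rfl fun ρ _ => ?_
  rw [Finset.sum_eq_single a0]
  · rw [if_pos (by simp [Equiv.funSplitAt, Equiv.piSplitAt])]
    refine Finset.sum_congr rfl fun τ _ => ?_
    congr 1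
    funext k
    by_cases h : k = i
    · subst h; simp [Equiv.funSplitAt, Equiv.piSplitAt]
    · simp [Equiv.funSplitAt, Equiv.piSplitAt, h]
  · intro b _ hb
    rw [if_neg (by simpa [Equiv.funSplitAt, Equiv.piSplitAt] using hb)]
  · simp

theorem C_self (N i : Fin n) (u : Fin n → Fin n → (Fin n → K)) :
    C N i u = ∑ σ : Fin n → Equiv.Perm (Fin n), if σ i = 1 then
      (∏ k ∈ univ.erase i, wt K N i k (σ k)) *
        ∑ τ : Equiv.Perm (Fin n), (if τ i = N then sg K τ else 0) *
          P (Function.update (mix i u σ) i (fun j => Pi.single (τ j) 1)) else 0 := by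
  unfold C
  rw [sum_split 1 i]
  refine Finset.sum_congr rfl fun σ _ => ?_
  split_ifs with h
  · rw [Finset.mul_sum]
    refine Finset.sum_congr rfl fun τ _ => ?_
    rw [← Finset.mul_prod_erase univ _ (Finset.mem_univ i)]
    have h1 : ∏ k ∈ univ.erase i, wt K N i k (Function.update σ i τ k) =
        ∏ k ∈ univ.erase i, wt K N i k (σ k) := by
      refine Finset.prod_congr rfl fun k hk => ?_
      rw [Function.update_of_ne (Finset.ne_of_mem_erase hk)]
    have h2 : mix i u (Function.update σ i τ) =
        Function.update (mix i u σ) i (fun j => (Pi.single (τ j) 1 : Fin n → K)) := by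
      funext k
      by_cases hk : k = i
      · subst hk; funext j; simp [mix]
      · funext j; simp [mix, hk]
    rw [h1, h2]
    simp only [wt, Function.update_self, lt_irrefl, if_false]
    ring
  · rfl

theorem C_succ (N i : Fin n) (u : Fin n → Fin n → (Fin n → K)) (x : Fin n → Fin n → K) :
    C N ((i : ℕ) + 1) (Function.update u i x) =
      ∑ σ : Fin n → Equiv.Perm (Fin n), if σ i = 1 then
      (∏ k ∈ univ.erase i, wt K N i k (σ k)) *
          P (Function.update (mix i u σ) i x) else 0 := by
  unfold C
  refine Finset.sum_congr rfl fun σ _ => ?_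
  rw [← Finset.mul_prod_erase univ _ (Finset.mem_univ i)]
  have hlt : ∀ k : Fin n, k ≠ i → ((k : ℕ) < i + 1 ↔ (k : ℕ) < i) := by
    intro k hk
    have : (k : ℕ) ≠ i := fun h => hk (Fin.ext h)
    omega
  have h1 : ∏ k ∈ univ.erase i, wt K N (i + 1) k (σ k) =
      ∏ k ∈ univ.erase i, wt K N i k (σ k) := by
    refine Finset.prod_congr rfl fun k hk => ?_
    simp only [wt, hlt k (Finset.ne_of_mem_erase hk)]
  have h2 : mix (i + 1) (Function.update u i x) σ = Function.update (mix i u σ) i x := by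
    funext k
    by_cases hk : k = i
    · subst hk; funext j; simp [mix]
    · funext j; simp only [mix, hlt k hk, ne_eq, hk, not_false_eq_true, Function.update_of_ne]
  rw [h1, h2]
  have h3 : wt K N (i + 1) i (σ i) = if σ i = 1 then 1 else 0 := by simp [wt]
  rw [h3]
  split_ifs <;> simp

theorem step (N i : Fin n) (u : Fin n → Fin n → (Fin n → K))
    (hu : ∀ k : Fin n, (k : ℕ) < i → u k k = Pi.single N 1)
    (w : Fin n → Fin n → K) (j0 : Fin n) (hw : w j0 = Pi.single N 1) :
    ∑ π : Equiv.Perm (Fin n), (if π i = j0 then sg K π else 0) *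
        C N ((i : ℕ) + 1) (Function.update u i (fun j => w (π j))) =
      Matrix.det (Matrix.of w) * C N i u := by
  simp only [C_succ]
  rw [C_self, Finset.mul_sum]
  simp only [Finset.mul_sum (s := univ (α := Fin n → Equiv.Perm (Fin n)))]
  rw [Finset.sum_comm]
  refine Finset.sum_congr rfl fun σ _ => ?_
  split_ifs with h
  · by_cases hA : ∏ k ∈ univ.erase i, wt K N i k (σ k) = 0
    · simp [hA]
    · rw [← ne_eq, Finset.prod_ne_zero_iff] at hA
      have hQ : ∀ k, k ≠ i → mix i u σ k k = Pi.single N 1 := by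
        intro k hk
        have := hA k (Finset.mem_erase.2 ⟨hk, Finset.mem_univ _⟩)
        unfold mix
        split_ifs with hlt
        · exact hu k hlt
        · simp only [wt, hlt, if_false] at this
          by_cases hN : σ k k = N
          · rw [hN]
          · simp [hN] at this
      have := key (mix i u σ) N i hQ w j0 hw
      calc _ = (∏ k ∈ univ.erase i, wt K N i k (σ k)) * ∑ π : Equiv.Perm (Fin n),
            (if π i = j0 then sg K π else 0) *
              P (Function.update (mix i u σ) i (fun j => w (π j))) := by
            rw [Finset.mul_sum]
            exact Finset.sum_congr rfl fun π _ => by ring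
        _ = _ := by rw [this]; ring
  · simp

theorem exists_good (N i : Fin n) (u : Fin n → Fin n → (Fin n → K))
    (hu : ∀ k : Fin n, (k : ℕ) < i → u k k = Pi.single N 1)
    (w : Fin n → Fin n → K) (hw : ∃ j0, w j0 = Pi.single N 1)
    (hdet : Matrix.det (Matrix.of w) ≠ 0) (hC : C N i u ≠ 0) :
    ∃ π : Equiv.Perm (Fin n), w (π i) = Pi.single N 1 ∧
      C N ((i : ℕ) + 1) (Function.update u i (fun j => w (π j))) ≠ 0 := by
  obtain ⟨j0, hw⟩ := hw
  have h := step N i u hu w j0 hw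
  have h0 : Matrix.det (Matrix.of w) * C N i u ≠ 0 := mul_ne_zero hdet hC
  rw [← h] at h0
  obtain ⟨π, _, hπ⟩ := Finset.exists_ne_zero_of_sum_ne_zero h0
  refine ⟨π, ?_, right_ne_zero_of_mul hπ⟩
  have := left_ne_zero_of_mul hπ
  by_cases hj : π i = j0
  · rw [hj, hw]
  · simp [hj] at this

theorem C_last (N : Fin n) (u : Fin n → Fin n → (Fin n → K)) : C N n u = P u := by
  unfold C
  rw [Finset.sum_eq_single (fun _ => 1)]
  · have : mix n u (fun _ => 1) = u := by funext k j; simp [mix]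
    rw [this]; simp [wt]
  · intro σ _ hσ
    obtain ⟨k, hk⟩ := Function.ne_iff.1 hσ
    apply mul_eq_zero_of_left
    apply Finset.prod_eq_zero (Finset.mem_univ k)
    simp [wt, hk]
  · simp

theorem C_zero (N : Fin n) (hN : (N : ℕ) = n - 1) (u : Fin n → Fin n → (Fin n → K)) :
    C N 0 u = ((latinSquareDiagSignedCount n : ℤ) : K) := by
  unfold C latinSquareDiagSignedCount
  rw [Finset.sum_filter, Fintype.sum_prod_type]
  push_cast
  refine Finset.sum_congr rfl fun r _ => ?_
  have hP : P (mix 0 u r) = ∑ c : Fin n → Equiv.Perm (Fin n),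
      if (∀ i j, c j i = r i j) then ∏ j, sg K (c j) else 0 := by
    unfold P
    have : ∀ j, Matrix.det (Matrix.of fun i => mix 0 u r i j) =
        ∑ c : Equiv.Perm (Fin n), if (∀ i, c i = r i j) then sg K c else 0 := by
      intro j
      rw [← Matrix.det_transpose, Matrix.det_apply']
      refine Finset.sum_congr rfl fun c _ => ?_
      simp only [mix, Nat.not_lt_zero, if_false, Matrix.transpose_apply, Matrix.of_apply,
        Pi.single_apply, Finset.prod_ite_zero, Finset.mem_univ, true_imp_iff]
      split_ifs <;> simp [sg]
    simp only [this]
    rw [Finset.prod_univ_sum, Fintype.piFinset_univ]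
    refine Finset.sum_congr rfl fun c _ => ?_
    rw [Finset.prod_ite_zero]
    simp only [Finset.mem_univ, true_imp_iff]
    congr 1
    exact propext forall_comm
  rw [hP, Finset.mul_sum]
  refine Finset.sum_congr rfl fun c _ => ?_
  have hw : ∏ k, wt K N 0 k (r k) =
      if (∀ i, ((r i i : Fin n) : ℕ) = n - 1) then ∏ k, sg K (r k) else 0 := by
    simp only [wt, Nat.not_lt_zero, if_false]
    rw [Finset.prod_ite_zero]
    simp only [Finset.mem_univ, true_imp_iff, Fin.ext_iff, hN]
  rw [hw]
  by_cases h1 : ∀ i j, c j i = r i j <;> by_cases h2 : ∀ i, ((r i i : Fin n) : ℕ) = n - 1 <;>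
    simp [h1, h2, sg]

open Classical in
/-- choice of the permutation -/
def pick (N i : Fin n) (u : Fin n → Fin n → (Fin n → K)) (w : Fin n → Fin n → K) :
    Equiv.Perm (Fin n) :=
  if h : ∃ π : Equiv.Perm (Fin n), w (π i) = Pi.single N 1 ∧
      C N ((i : ℕ) + 1) (Function.update u i (fun j => w (π j))) ≠ 0 then h.choose else 1

/-- arranged array after some rows -/
def R (N : Fin n) (v : Fin n → Fin n → (Fin n → K)) : ℕ → Fin n → Fin n → (Fin n → K)
  | 0 => 0
  | i + 1 => if h : i < n then
      Function.update (R N v i) ⟨i, h⟩ (fun j => v ⟨i, h⟩ (pick N ⟨i, h⟩ (R N v i) (v ⟨i, h⟩) j))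
    else R N v i

theorem R_congr (N : Fin n) (v v' : Fin n → Fin n → (Fin n → K)) (i : ℕ)
    (h : ∀ k : Fin n, (k : ℕ) < i → v k = v' k) : R N v i = R N v' i := by
  induction i with
  | zero => rfl
  | succ i ih =>
    have ih' := ih fun k hk => h k (by omega)
    unfold R
    split_ifs with hi
    · rw [ih', h ⟨i, hi⟩ (by simp)]
    · exact ih'

theorem R_inv (N : Fin n) (v : Fin n → Fin n → (Fin n → K))
    (h0 : C N 0 (R N v 0) ≠ 0)
    (hdet : ∀ i, Matrix.det (Matrix.of (v i)) ≠ 0)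
    (hw : ∀ i, ∃ j0, v i j0 = Pi.single N 1) (i : ℕ) (hi : i ≤ n) :
    C N i (R N v i) ≠ 0 ∧ (∀ k : Fin n, (k : ℕ) < i → R N v i k k = Pi.single N 1) ∧
    ∀ k : Fin n, (k : ℕ) < i → R N v i k = fun j => v k (pick N k (R N v k) (v k) j) := by
  induction i with
  | zero => exact ⟨h0, by simp, by simp⟩
  | succ i ih =>
    have hi' : i < n := hi
    obtain ⟨a, b, c⟩ := ih hi'.le
    have hex := exists_good N ⟨i, hi'⟩ (R N v i) b (v ⟨i, hi'⟩) (hw _) (hdet _) a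
    have hR : R N v (i + 1) = Function.update (R N v i) ⟨i, hi'⟩
        (fun j => v ⟨i, hi'⟩ (pick N ⟨i, hi'⟩ (R N v i) (v ⟨i, hi'⟩) j)) := by
      rw [R, dif_pos hi']
    have hp := hex.choose_spec
    have hpick : pick N ⟨i, hi'⟩ (R N v i) (v ⟨i, hi'⟩) = hex.choose := by
      unfold pick; rw [dif_pos hex]
    rw [← hpick] at hp
    rw [hR]
    refine ⟨hp.2, ?_, ?_⟩
    · intro k hk
      by_cases hki : k = ⟨i, hi'⟩
      · subst hki; rw [Function.update_self]; exact hp.1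
      · rw [Function.update_of_ne hki]
        exact b k (by have : (k : ℕ) ≠ i := fun h => hki (Fin.ext h)
                      omega)
    · intro k hk
      by_cases hki : k = ⟨i, hi'⟩
      · subst hki; rw [Function.update_self]
      · rw [Function.update_of_ne hki]
        exact c k (by have : (k : ℕ) ≠ i := fun h => hki (Fin.ext h)
                      omega)

/-- extend a history by zero rows -/
def ext (i : Fin n) (h : Fin ((i : ℕ) + 1) → Fin n → (Fin n → K)) :
    Fin n → Fin n → (Fin n → K) :=
  fun k => if hk : (k : ℕ) < i + 1 then h ⟨k, hk⟩ else 0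

theorem ext_apply (i : Fin n) (v : Fin n → Fin n → (Fin n → K)) (k : Fin n)
    (hk : (k : ℕ) < i + 1) : ext i (fun k => v (Fin.castLE i.isLt k)) k = v k := by
  unfold ext
  rw [dif_pos hk]
  rfl

end OnlineRota

end OnlineRota

/-- If the signed count of Latin squares of order `n` with all diagonal
entries equal to the symbol `n` is nonzero in `K`, then there is an online
algorithm which takes `n` bases of `K^n`, each containing the standard basis
vector `e_n`, and arranges them as the rows of an `n × n` array whose columns
are again bases.  The strategy `s i` sees only rows `0, …, i` (in
`Fin`-indexing) and outputs the permutation to be applied to row `i`. -/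
theorem online_rota_common_vector_of_diag_latin_signed_count_ne_zero
    (n : ℕ) (hn : 0 < n) (K : Type*) [Field K]
    (hchar : ((latinSquareDiagSignedCount n : ℤ) : K) ≠ 0) :
    ∃ s : (i : Fin n) → (Fin ((i : ℕ) + 1) → Fin n → (Fin n → K)) → Equiv.Perm (Fin n),
      ∀ v : Fin n → Fin n → (Fin n → K),
        (∀ i, (LinearIndependent K (v i) ∧
            Submodule.span K (Set.range (v i)) = ⊤) ∧
          ∃ j₀, v i j₀ = Pi.single (⟨n - 1, by omega⟩ : Fin n) (1 : K)) →
        ∀ j, LinearIndependent K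
            (fun i => v i (s i (fun k => v (Fin.castLE i.isLt k)) j)) ∧
          Submodule.span K
            (Set.range fun i => v i (s i (fun k => v (Fin.castLE i.isLt k)) j)) = ⊤ := by
  set N : Fin n := ⟨n - 1, by omega⟩ with hN
  refine ⟨fun i h => OnlineRota.pick N i (OnlineRota.R N (OnlineRota.ext i h) i)
    (OnlineRota.ext i h i), ?_⟩
  intro v hv
  have hs : ∀ i : Fin n, OnlineRota.pick N i
      (OnlineRota.R N (OnlineRota.ext i (fun k => v (Fin.castLE i.isLt k))) i)
      (OnlineRota.ext i (fun k => v (Fin.castLE i.isLt k)) i) =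
      OnlineRota.pick N i (OnlineRota.R N v i) (v i) := by
    intro i
    rw [OnlineRota.ext_apply i v i (Nat.lt_succ_self _), OnlineRota.R_congr N _ v i
      (fun k hk => OnlineRota.ext_apply i v k (by omega))]
  have hdet : ∀ i, Matrix.det (Matrix.of (v i)) ≠ 0 := by
    intro i
    have h := (hv i).1.1
    exact ((Matrix.isUnit_iff_isUnit_det _).1
      ((Matrix.linearIndependent_rows_iff_isUnit (A := Matrix.of (v i))).1 h)).ne_zero
  have hinv := OnlineRota.R_inv N v (by rw [OnlineRota.C_zero N rfl]; exact hchar) hdet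
    (fun i => (hv i).2) n le_rfl
  obtain ⟨hC, -, hR⟩ := hinv
  rw [OnlineRota.C_last] at hC
  unfold OnlineRota.P at hC
  rw [Finset.prod_ne_zero_iff] at hC
  intro j
  have hcol : (fun i => OnlineRota.R N v n i j) =
      fun i => v i (OnlineRota.pick N i (OnlineRota.R N v i) (v i) j) := by
    funext i
    rw [hR i i.isLt]
  have hd := hC j (Finset.mem_univ j)
  rw [hcol] at hd
  simp only [hs]
  have hli : LinearIndependent K
      (fun i => v i (OnlineRota.pick N i (OnlineRota.R N v i) (v i) j)) :=
    (Matrix.linearIndependent_rows_iff_isUnit (A := Matrix.of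
      (fun i => v i (OnlineRota.pick N i (OnlineRota.R N v i) (v i) j)))).2
      ((Matrix.isUnit_iff_isUnit_det _).2 (isUnit_iff_ne_zero.2 hd))
  exact ⟨hli, hli.span_eq_top_of_card_eq_finrank' (by simp)⟩
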